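/- In the abstract word model below, let (F, R) be a shift-invariant dynamics such that F : A → A is a bijection with inverse F⁻¹, and let S : A → List α → List α satisfy: (i) for all a and all u with mem a u, S (F a) (R a u) = u; (ii) for all b and all u' with mem b u', mem (F⁻¹ b) (S b u') holds and R (F⁻¹ b) (S b u') = u'. Then (F⁻¹, S) is a shift-invariant dynamics: for all b : A and all words u', v' with mem b u' and mem (shift b u') v', one has F⁻¹ (shift b u') = shift (F⁻¹ b) (S b u') and S b (u' ++ v') = (S b u') ++ (S (shift b u') v'). [This is the paper's Lemma: if (F, R) is an invertible shift-invariant dynamics such that each R_X is a bijection on vertices, then (F⁻¹, S) with S_Y = (R_{F⁻¹(Y)})⁻¹ is a shift-invariant dynamics.] -/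

import Mathlib

/-- In the abstract word model, if `(F, R)` is a shift-invariant dynamics with
`F` a bijection with inverse `Finv`, and `S` inverts `R` fibrewise, then
`(Finv, S)` is a shift-invariant dynamics. -/
theorem inverse_of_shift_invariant_dynamics_is_shift_invariant
    {A α : Type*}
    (shift : A → List α → A) (mem : A → List α → Prop)
    (hshift_nil : ∀ a : A, shift a [] = a)
    (hshift_app : ∀ (a : A) (u v : List α), shift a (u ++ v) = shift (shift a u) v)
    (hmem_nil : ∀ a : A, mem a [])
    (hmem_app : ∀ (a : A) (u v : List α),
      mem a (u ++ v) ↔ (mem a u ∧ mem (shift a u) v))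
    (F : A → A) (R : A → List α → List α)
    (hF_shift : ∀ (a : A) (u : List α), mem a u →
      F (shift a u) = shift (F a) (R a u))
    (hR_mem : ∀ (a : A) (u : List α), mem a u → mem (F a) (R a u))
    (hR_app : ∀ (a : A) (u v : List α), mem a u → mem (shift a u) v →
      R a (u ++ v) = R a u ++ R (shift a u) v)
    (Finv : A → A)
    (hFinv_left : ∀ a : A, Finv (F a) = a)
    (hFinv_right : ∀ b : A, F (Finv b) = b)
    (S : A → List α → List α)
    (hS_left : ∀ (a : A) (u : List α), mem a u → S (F a) (R a u) = u)
    (hS_right : ∀ (b : A) (u' : List α), mem b u' →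
      mem (Finv b) (S b u') ∧ R (Finv b) (S b u') = u') :
    ∀ (b : A) (u' v' : List α), mem b u' → mem (shift b u') v' →
      Finv (shift b u') = shift (Finv b) (S b u') ∧
      S b (u' ++ v') = S b u' ++ S (shift b u') v' := by
  intro b u' v' hu' hv'
  obtain ⟨hu, hRu⟩ := hS_right b u' hu'
  obtain ⟨hv, hRv⟩ := hS_right (shift b u') v' hv'
  have hshift : Finv (shift b u') = shift (Finv b) (S b u') := by
    rw [← hFinv_left (shift (Finv b) (S b u')), hF_shift _ _ hu, hFinv_right, hRu]
  refine ⟨hshift, ?_⟩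
  rw [hshift] at hv hRv
  have h := hS_left _ _ ((hmem_app _ _ _).2 ⟨hu, hv⟩)
  rwa [hR_app _ _ _ hu hv, hRu, hRv, hFinv_right] at h
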